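/- The spectrum of Alice's reduced state for n bunched photons through a beamsplitter with transmission amplitude c (|c|² = p) is the binomial distribution λ_k = C(n,k)·p^k·(1-p)^(n-k), and its Shannon entropy equals (1/2)·log₂(2πe·n·p·(1-p)) + O(1/n) as n → ∞. -/

import Mathlib

open Real

lemma be_min (f f' : ℝ → ℝ) (hf : ∀ u, 0 < u → HasDerivAt f (f' u) u)
    (h1 : f 1 = 0) (hpos : ∀ u, 1 < u → 0 ≤ f' u) (hneg : ∀ u, 0 < u → u < 1 → f' u ≤ 0)
    (u : ℝ) (hu : 0 < u) : 0 ≤ f u := by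
  rcases le_total u 1 with h | h
  · have : AntitoneOn f (Set.Icc u 1) := by
      apply antitoneOn_of_deriv_nonpos (convex_Icc u 1)
      · intro x hx
        exact (hf x (by linarith [hx.1])).continuousAt.continuousWithinAt
      · intro x hx
        rw [interior_Icc] at hx
        exact (hf x (by linarith [hx.1])).differentiableAt.differentiableWithinAt
      · intro x hx
        rw [interior_Icc] at hx
        rw [(hf x (by linarith [hx.1])).deriv]
        exact hneg x (by linarith [hx.1]) hx.2
    have := this ⟨le_refl u, h⟩ ⟨h, le_refl 1⟩ h
    linarith
  · have : MonotoneOn f (Set.Icc 1 u) := by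
      apply monotoneOn_of_deriv_nonneg (convex_Icc 1 u)
      · intro x hx
        exact (hf x (by linarith [hx.1])).continuousAt.continuousWithinAt
      · intro x hx
        rw [interior_Icc] at hx
        exact (hf x (by linarith [hx.1])).differentiableAt.differentiableWithinAt
      · intro x hx
        rw [interior_Icc] at hx
        rw [(hf x (by linarith [hx.1])).deriv]
        exact hpos x hx.1
    have := this ⟨le_refl 1, h⟩ ⟨h, le_refl u⟩ h
    linarith

lemma be_upper (u : ℝ) (hu : 0 < u) :
    u * log u ≤ (u-1) + (u-1)^2/2 - (u-1)^3/6 + (u-1)^4/3 := by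
  have h := be_min (fun u => (u-1) - (u-1)^2/2 + (u-1)^3/3 - log u)
    (fun u => (u-1)^3/u) (by
      intro u hu
      have h1 : HasDerivAt (fun u : ℝ => u - 1) 1 u := (hasDerivAt_id u).sub_const 1
      have := ((h1.sub ((h1.pow 2).div_const 2)).add ((h1.pow 3).div_const 3)).sub
        (Real.hasDerivAt_log hu.ne')
      refine this.congr_deriv ?_
      field_simp
      ring) (by simp)
    (fun u h => by
      have : 0 < u - 1 := by linarith
      positivity)
    (fun u h0 h => by
      apply div_nonpos_of_nonpos_of_nonneg _ h0.le
      exact Odd.pow_nonpos (by decide) (by linarith)) u hu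
  have := mul_le_mul_of_nonneg_left (sub_nonneg.1 h) hu.le
  nlinarith

lemma be_lower (u : ℝ) (hu : 0 < u) :
    (u-1) + (u-1)^2/2 - (u-1)^3/6 ≤ u * log u := by
  have h := be_min (fun u => log u - ((u-1) + (u-1)^2/2 - (u-1)^3/6)/u)
    (fun u => (u-1)^3/(3*u^2)) (by
      intro u hu
      have h1 : HasDerivAt (fun u : ℝ => u - 1) 1 u := (hasDerivAt_id u).sub_const 1
      have := (Real.hasDerivAt_log hu.ne').sub
        (((h1.add ((h1.pow 2).div_const 2)).sub ((h1.pow 3).div_const 6)).div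
          (hasDerivAt_id u) hu.ne')
      refine this.congr_deriv ?_
      simp
      field_simp
      ring) (by simp)
    (fun u h => by
      have : 0 < u - 1 := by linarith
      positivity)
    (fun u h0 h => by
      apply div_nonpos_of_nonpos_of_nonneg _ (by positivity)
      exact Odd.pow_nonpos (by decide) (by linarith)) u hu
  have := mul_le_mul_of_nonneg_left (sub_nonneg.1 h) hu.le
  rwa [mul_div_cancel₀ _ hu.ne'] at this

/-- `E n p f` : binomial expectation -/
noncomputable def beE (p : ℝ) (n : ℕ) (f : ℕ → ℝ) : ℝ :=
  ∑ k ∈ Finset.range (n + 1), ((n.choose k : ℝ) * p ^ k * (1 - p) ^ (n - k)) * f k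

lemma beE_succ (p : ℝ) (n : ℕ) (f : ℕ → ℝ) :
    beE p (n+1) f = (1-p) * beE p n f + p * beE p n (fun k => f (k+1)) := by
  unfold beE
  rw [Finset.sum_range_succ', Finset.mul_sum, Finset.mul_sum]
  have h1 : ∑ k ∈ Finset.range (n+1), (1-p) * (((n.choose k : ℝ) * p ^ k * (1 - p) ^ (n - k)) * f k)
     = ∑ k ∈ Finset.range (n+1), ((n.choose (k+1) : ℝ) * p ^ (k+1) * (1 - p) ^ (n - k)) * f (k+1)
      + (1-p)^(n+1) * f 0 := by
    rw [Finset.sum_range_succ', Finset.sum_range_succ (n := n)]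
    simp only [Nat.choose_succ_self, Nat.choose_zero_right]
    have : ∀ k ∈ Finset.range n, (1-p) * (((n.choose (k+1) : ℝ) * p ^ (k+1) * (1 - p) ^ (n - (k+1))) * f (k+1)) = ((n.choose (k+1) : ℝ) * p ^ (k+1) * (1 - p) ^ (n - k)) * f (k+1) := by
      intro k hk
      have hk := Finset.mem_range.1 hk
      have : n - k = (n - (k+1)) + 1 := by omega
      rw [this, pow_succ (1-p)]; ring
    rw [Finset.sum_congr rfl this]
    simp [pow_succ]; ring
  rw [h1, add_right_comm, ← Finset.sum_add_distrib]
  congr 1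
  · apply Finset.sum_congr rfl
    intro k hk
    rw [Nat.choose_succ_succ]
    push_cast
    simp only [Nat.succ_eq_add_one, pow_succ p]; ring
  · simp

lemma beE_add (p : ℝ) (n : ℕ) (f g : ℕ → ℝ) :
    beE p n (fun k => f k + g k) = beE p n f + beE p n g := by
  simp [beE, mul_add, Finset.sum_add_distrib]

lemma beE_sub (p : ℝ) (n : ℕ) (f g : ℕ → ℝ) :
    beE p n (fun k => f k - g k) = beE p n f - beE p n g := by
  simp [beE, mul_sub, Finset.sum_sub_distrib]

lemma beE_cmul (p : ℝ) (n : ℕ) (c : ℝ) (g : ℕ → ℝ) :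
    beE p n (fun k => c * g k) = c * beE p n g := by
  simp only [beE, Finset.mul_sum]
  exact Finset.sum_congr rfl fun k _ => by ring

lemma beE_one (p : ℝ) (n : ℕ) : beE p n (fun _ => 1) = 1 := by
  induction n with
  | zero => simp [beE]
  | succ n ih => rw [beE_succ, ih]; ring

lemma beE_const (p : ℝ) (n : ℕ) (c : ℝ) : beE p n (fun _ => c) = c := by
  have := beE_cmul p n c (fun _ => 1)
  simpa [beE_one] using this

/-- expectation of a quartic in the centred variable -/
lemma beE_quartic (p : ℝ) (n : ℕ) : ∀ a b c d e : ℝ,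
    beE p n (fun k => a + b * (k - n*p) + c * (k - n*p)^2 + d * (k-n*p)^3 + e * (k-n*p)^4)
     = a + c * (n*p*(1-p)) + d * (n*p*(1-p)*(1-2*p)) +
       e * (3*n*(n-1)*p^2*(1-p)^2 + n*p*(1-p)*(1-3*p*(1-p))) := by
  induction n with
  | zero => intro a b c d e; simp [beE]
  | succ n ih =>
    intro a b c d e
    rw [beE_succ]
    have h1 := ih (a - b*p + c*p^2 - d*p^3 + e*p^4) (b - 2*c*p + 3*d*p^2 - 4*e*p^3)
      (c - 3*d*p + 6*e*p^2) (d - 4*e*p) e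
    have h2 := ih (a + b*(1-p) + c*(1-p)^2 + d*(1-p)^3 + e*(1-p)^4) (b + 2*c*(1-p) + 3*d*(1-p)^2 + 4*e*(1-p)^3)
      (c + 3*d*(1-p) + 6*e*(1-p)^2) (d + 4*e*(1-p)) e
    have e1 : (fun k : ℕ => a + b * ((k:ℝ) - (n+1:ℕ)*p) + c * (k - (n+1:ℕ)*p)^2 + d * (k-(n+1:ℕ)*p)^3 + e * (k-(n+1:ℕ)*p)^4) = (fun k : ℕ => (a - b*p + c*p^2 - d*p^3 + e*p^4) + (b - 2*c*p + 3*d*p^2 - 4*e*p^3) * (k - n*p) + (c - 3*d*p + 6*e*p^2) * (k - n*p)^2 + (d - 4*e*p) * (k-n*p)^3 + e * (k-n*p)^4) := by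
      funext k; push_cast; ring
    have e2 : (fun k : ℕ => a + b * (((k+1:ℕ):ℝ) - (n+1:ℕ)*p) + c * ((k+1:ℕ) - (n+1:ℕ)*p)^2 + d * ((k+1:ℕ)-(n+1:ℕ)*p)^3 + e * ((k+1:ℕ)-(n+1:ℕ)*p)^4) = (fun k : ℕ => (a + b*(1-p) + c*(1-p)^2 + d*(1-p)^3 + e*(1-p)^4) + (b + 2*c*(1-p) + 3*d*(1-p)^2 + 4*e*(1-p)^3) * (k - n*p) + (c + 3*d*(1-p) + 6*e*(1-p)^2) * (k - n*p)^2 + (d + 4*e*(1-p)) * (k-n*p)^3 + e * (k-n*p)^4) := by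
      funext k; push_cast; ring
    rw [e1, e2, h1, h2]
    push_cast
    ring

lemma beE_mono (p : ℝ) (hp0 : 0 < p) (hp1 : p < 1) (n : ℕ) (f g : ℕ → ℝ) (h : ∀ k ≤ n, f k ≤ g k) :
    beE p n f ≤ beE p n g := by
  unfold beE
  apply Finset.sum_le_sum
  intro k hk
  have := Finset.mem_range.1 hk
  have h1 : 0 < 1 - p := by linarith
  exact mul_le_mul_of_nonneg_left (h k (by omega)) (by positivity)

lemma beE_bias (p : ℝ) (n : ℕ) (hp0 : 0 < p) (hp1 : p < 1) (g : ℕ → ℝ) (h0 : 0 ≤ g 0) :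
    beE p n (fun k => g (k+1) / (k+1)) ≤ beE p (n+1) g / ((n+1)*p) := by
  have h1 : 0 < 1 - p := by linarith
  rw [le_div_iff₀ (by positivity)]
  unfold beE
  rw [Finset.sum_range_succ' _ (n+1), Finset.sum_mul]
  have : ∀ k ∈ Finset.range (n+1), ((n.choose k : ℝ) * p ^ k * (1 - p) ^ (n - k)) * (g (k+1)/(k+1)) * ((n+1)*p)
    = (((n+1).choose (k+1) : ℝ) * p ^ (k+1) * (1 - p) ^ (n +1 - (k+1))) * g (k+1) := by
    intro k hk
    have h2 : ((n:ℝ)+1) * n.choose k = (n+1).choose (k+1) * (k+1) := by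
      exact_mod_cast Nat.add_one_mul_choose_eq n k
    rw [Nat.add_sub_add_right]
    field_simp
    rw [pow_succ]
    linear_combination (p^k * g (k+1) * p) * h2
  rw [Finset.sum_congr rfl this]
  have : 0 ≤ (((n+1).choose 0 : ℝ) * p ^ 0 * (1 - p) ^ (n+1-0)) * g 0 := by positivity
  linarith

lemma beE_refl (p : ℝ) (n : ℕ) (f : ℕ → ℝ) :
    beE p n (fun k => f (n-k)) = beE (1-p) n f := by
  unfold beE
  rw [← Finset.sum_range_reflect]
  apply Finset.sum_congr rfl
  intro k hk
  have hk : k ≤ n := by have := Finset.mem_range.1 hk; omega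
  rw [show n + 1 - 1 - k = n - k by omega, Nat.choose_symm hk]
  simp only [Nat.sub_sub_self hk, sub_sub_cancel]
  ring

lemma be_stirling (k : ℕ) : ∃ ε : ℝ, 0 ≤ ε ∧ ε ≤ 1/(2*((k:ℝ)+1)) ∧
    log (k.factorial) = ((k:ℝ)+1/2) * log (k+1) - (k+1) + 1/2 * log (2*π) + ε := by
  have hlim : Filter.Tendsto (fun k : ℕ => log (Stirling.stirlingSeq (k+1))) Filter.atTop (nhds (log √π)) :=
    ((Stirling.tendsto_stirlingSeq_sqrt_pi.comp (Filter.tendsto_add_atTop_nat 1)).log (by positivity))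
  have hlim2 : Filter.Tendsto (fun k : ℕ => log (Stirling.stirlingSeq (k+1)) - 1/2 * (1/((k:ℝ)+1))) Filter.atTop (nhds (log √π)) := by
    have := hlim.sub ((tendsto_one_div_add_atTop_nhds_zero_nat (𝕜 := ℝ)).const_mul (1/2))
    rwa [mul_zero, sub_zero] at this
  have hmono : Monotone (fun k : ℕ => log (Stirling.stirlingSeq (k+1)) - 1/2 * (1/((k:ℝ)+1))) := by
    apply monotone_nat_of_le_succ
    intro j
    have h := Stirling.log_stirlingSeq_sdiff_le (j+1)
    push_cast at h ⊢
    have : 1 / (12 * ((j:ℝ)+1)*(j+1+1)) ≤ 1/2 * (1/((j:ℝ)+1)) - 1/2 * (1/((j:ℝ)+1+1)) := by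
      have : 1/2 * (1/((j:ℝ)+1)) - 1/2 * (1/((j:ℝ)+1+1)) = 1/(2*((j:ℝ)+1)*(j+1+1)) := by
        field_simp; ring
      rw [this]
      apply one_div_le_one_div_of_le (by positivity)
      nlinarith [(j.cast_nonneg : (0:ℝ) ≤ j)]
    linarith
  have hub := hmono.ge_of_tendsto hlim2 k
  have hlb := Stirling.log_stirlingSeq'_antitone.le_of_tendsto hlim k
  simp only [Function.comp, Nat.succ_eq_add_one] at hub hlb
  refine ⟨log (Stirling.stirlingSeq (k+1)) - log √π, by linarith, ?_, ?_⟩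
  · have : 1/(2*((k:ℝ)+1)) = 1/2 * (1/((k:ℝ)+1)) := by field_simp
    linarith
  · have h := Stirling.log_stirlingSeq_formula (k+1)
    have hk : (0:ℝ) < k + 1 := by positivity
    rw [Nat.factorial_succ] at h
    push_cast at h
    rw [log_mul hk.ne' (by positivity), log_mul (by norm_num) hk.ne', log_div hk.ne' (exp_pos 1).ne', log_exp] at h
    rw [log_sqrt pi_pos.le, log_mul (by norm_num) pi_pos.ne', h]
    ring

lemma be_point (k : ℕ) (m : ℝ) (hm : 0 < m) :
    let P := ((k:ℝ)+1) * log m + (k+1-m) + (k+1-m)^2/(2*m) - (k+1-m)^3/(6*m^2) - 1/2 * log m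
      - (k+1-m)/(2*m) - (k+1) + 1/2 * log (2*π)
    P ≤ log (k.factorial) ∧
    log (k.factorial) ≤ P + (1/(3*m^3)) * (k+1-m)^4
      + ((((k+1:ℕ):ℝ)-m)^2/(2*m) + 1/2)/(k+1) := by
  intro P
  obtain ⟨ε, h0, h1, h2⟩ := be_stirling k
  obtain ⟨x, hx⟩ : ∃ x : ℝ, x = k + 1 := ⟨_, rfl⟩
  have hx0 : 0 < x := by rw [hx]; positivity
  push_cast
  rw [← hx] at h1
  simp only [P]
  rw [h2]
  have hk : (k:ℝ) = x - 1 := by linarith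
  rw [hk] at *
  simp only [sub_add_cancel] at *
  obtain ⟨u, hu⟩ : ∃ u : ℝ, u = x / m := ⟨_, rfl⟩
  have hu0 : 0 < u := by rw [hu]; positivity
  have hxu : x = m * u := by rw [hu]; field_simp
  have hl : log x = log m + log u := by rw [hxu, log_mul hm.ne' hu0.ne']
  have a1 := be_upper u hu0
  have a2 := be_lower u hu0
  have a3 := log_le_sub_one_of_pos hu0
  have a4 := one_sub_inv_le_log_of_pos hu0
  have b1 := mul_le_mul_of_nonneg_left a1 hm.le
  have b2 := mul_le_mul_of_nonneg_left a2 hm.le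
  have e1 : (x-m)^2/(2*m) = m * ((u-1)^2/2) := by rw [hxu]; field_simp
  have e2 : (x-m)^3/(6*m^2) = m * ((u-1)^3/6) := by rw [hxu]; field_simp
  have e3 : 1/(3*m^3) * (x-m)^4 = m * ((u-1)^4/3) := by rw [hxu]; field_simp
  have e4 : (x-m)/(2*m) = (u-1)/2 := by rw [hxu]; field_simp
  have e5 : (m * ((u-1)^2/2) + 1/2)/x = (u - 1 - (1-u⁻¹))/2 + 1/(2*x) := by
    rw [hxu]; field_simp
  rw [e1, e2, e3, e4, e5, hl, show x - m = m * (u-1) by rw [hxu]; ring]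
  have e6 : (x - 1 + 1/2) * (log m + log u) = x * log m - 1/2 * log m + m * (u * log u) - 1/2 * log u := by
    rw [hxu]; ring
  rw [e6]
  constructor <;> linarith

set_option maxHeartbeats 2000000 in
lemma be_main (p : ℝ) (hp0 : 0 < p) (hp1 : p < 1) : ∃ C : ℝ, 0 ≤ C ∧ ∀ n : ℕ,
    |beE p n (fun k => log (k.factorial)) -
      ((n*p+1/2) * log ((n+1)*p) + (1-p)/2 - (n+1)*p + 1/2 * log (2*π))| ≤ C/(n+1) := by
  refine ⟨(20/p^3 + 10/p^2) + 10/p, by positivity, fun n => ?_⟩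
  obtain ⟨N, hN⟩ : ∃ N : ℝ, N = n + 1 := ⟨_, rfl⟩
  have hn : (n:ℝ) = N - 1 := by linarith
  have hN1 : 1 ≤ N := by rw [hN]; linarith [(n.cast_nonneg : (0:ℝ) ≤ n)]
  obtain ⟨m, hm⟩ : ∃ m : ℝ, m = ((n:ℝ)+1)*p := ⟨_, rfl⟩
  have hm0 : 0 < m := by rw [hm]; positivity
  have hmN : m = N * p := by rw [hm, hN]
  have hq : 0 < 1 - p := by linarith
  set P : ℕ → ℝ := fun k => ((k:ℝ)+1) * log m + (k+1-m) + (k+1-m)^2/(2*m) - (k+1-m)^3/(6*m^2) - 1/2 * log m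
      - (k+1-m)/(2*m) - (k+1) + 1/2 * log (2*π) with hP
  have lo := beE_mono p hp0 hp1 n P (fun k => log (k.factorial)) (fun k _ => (be_point k m hm0).1)
  have hi := beE_mono p hp0 hp1 n (fun k => log (k.factorial))
    (fun k => P k + (1/(3*m^3)) * ((k:ℝ)+1-m)^4 + ((((k+1:ℕ):ℝ)-m)^2/(2*m) + 1/2)/(k+1))
    (fun k _ => (be_point k m hm0).2)
  rw [beE_add, beE_add, beE_cmul] at hi
  have hb := beE_bias p n hp0 hp1 (fun j => ((j:ℝ)-m)^2/(2*m) + 1/2) (by positivity)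
  have hg : beE p (n+1) (fun j => ((j:ℝ)-m)^2/(2*m) + 1/2) = (1-p)/2 + 1/2 := by
    have := beE_quartic p (n+1) (1/2) 0 (1/(2*m)) 0 0
    have e : (fun j : ℕ => ((j:ℝ)-m)^2/(2*m) + 1/2) = (fun k : ℕ => (1/2:ℝ) + 0 * (k - (n+1:ℕ)*p) + (1/(2*m)) * (k - (n+1:ℕ)*p)^2 + 0 * (k-(n+1:ℕ)*p)^3 + 0 * (k-(n+1:ℕ)*p)^4) := by
      funext k; push_cast; rw [← hm]; ring
    rw [e, this]
    push_cast
    rw [← hm]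
    field_simp
    ring
  rw [hg, ← hm] at hb
  have h4 : beE p n (fun k => ((k:ℝ)+1-m)^4) ≤ 20 * N^2 := by
    have := beE_quartic p n ((1-p)^4) (4*(1-p)^3) (6*(1-p)^2) (4*(1-p)) 1
    have e : (fun k : ℕ => ((k:ℝ)+1-m)^4) = (fun k : ℕ => (1-p)^4 + 4*(1-p)^3 * ((k:ℝ) - n*p) + 6*(1-p)^2 * (k - n*p)^2 + 4*(1-p) * (k-n*p)^3 + 1 * (k-n*p)^4) := by
      funext k; rw [hm]; ring
    rw [e, this]
    have hn0 : (0:ℝ) ≤ n := n.cast_nonneg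
    have t0 : (1-p)^2 ≤ 1 := pow_le_one₀ hq.le (by linarith)
    have t1 : (1-p)^4 ≤ 1 := pow_le_one₀ hq.le (by linarith)
    have hs0 : 0 ≤ p * (1-p) := by positivity
    have hs1 : p * (1-p) ≤ 1 := by nlinarith
    have hs2 : (p * (1-p))^2 ≤ 1 := pow_le_one₀ hs0 hs1
    have t2 : (1-p)^2 * (p*(1-p)) ≤ 1 := mul_le_one₀ t0 hs0 hs1
    have t3 : (1-p) * (p*(1-p)) * (1-2*p) ≤ 1 := by
      have : (1-p) * (p*(1-p)) ≤ 1 := mul_le_one₀ (by linarith) hs0 hs1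
      have h0 : 0 ≤ (1-p) * (p*(1-p)) := by positivity
      nlinarith
    have t4 : p*(1-p)*(1-3*p*(1-p)) ≤ 1 := by nlinarith
    have u2 := mul_le_mul_of_nonneg_left t2 hn0
    have u3 := mul_le_mul_of_nonneg_left t3 hn0
    have u4 := mul_le_mul_of_nonneg_left t4 hn0
    have u5 := mul_le_mul_of_nonneg_left hs2 (mul_nonneg hn0 hn0)
    have u6 : 0 ≤ n * (p*(1-p))^2 := by positivity
    rw [hN]
    nlinarith
  have hEP : beE p n P - ((n*p+1/2) * log m + (1-p)/2 - m + 1/2 * log (2*π)) =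
      -(1-p)*p/(2*m) + (1-p)^2/(2*m) - (1-p)/(2*m) - (n*p*(1-p)*(1-2*p) + 3 * n*p*(1-p)^2 + (1-p)^3)/(6*m^2) := by
    have := beE_quartic p n ((n*p+1) * log m + (1-p) + (1-p)^2/(2*m) - (1-p)^3/(6*m^2) - 1/2 * log m - (1-p)/(2*m) - (n*p+1) + 1/2 * log (2*π))
      (log m + (1-p)/m - 3*(1-p)^2/(6*m^2) - 1/(2*m)) (1/(2*m) - 3*(1-p)/(6*m^2)) (-1/(6*m^2)) 0
    have e : P = (fun k : ℕ => ((n*p+1) * log m + (1-p) + (1-p)^2/(2*m) - (1-p)^3/(6*m^2) - 1/2 * log m - (1-p)/(2*m) - (n*p+1) + 1/2 * log (2*π)) + (log m + (1-p)/m - 3*(1-p)^2/(6*m^2) - 1/(2*m)) * ((k:ℝ) - n*p) + (1/(2*m) - 3*(1-p)/(6*m^2)) * (k - n*p)^2 + (-1/(6*m^2)) * (k-n*p)^3 + 0 * (k-n*p)^4) := by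
      funext k
      have : (k:ℝ) + 1 - m = (k - n*p) + (1-p) := by rw [hm]; ring
      simp only [hP]
      rw [this]
      field_simp
      ring
    rw [e, this]
    obtain ⟨L, hL⟩ : ∃ L, L = log m := ⟨_, rfl⟩
    rw [← hL]
    have hn' : (n:ℝ) * p = m - p := by rw [hm]; ring
    have : (n:ℝ) = (m-p)/p := by rw [← hn']; field_simp
    rw [this]
    field_simp
    ring
  have hB : |-(1-p)*p/(2*m) + (1-p)^2/(2*m) - (1-p)/(2*m) - (n*p*(1-p)*(1-2*p) + 3 * n*p*(1-p)^2 + (1-p)^3)/(6*m^2)| ≤ 2/m + 10*N/m^2 := by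
    have hn0 : (0:ℝ) ≤ n := n.cast_nonneg
    have hs0 : 0 ≤ p * (1-p) := by positivity
    have hs1 : p * (1-p) ≤ 1 := by nlinarith
    have t1 : (1-p)^3 ≤ 1 := pow_le_one₀ hq.le (by linarith)
    have t1' : 0 ≤ (1-p)^3 := by positivity
    have t2 : p*(1-p)*(1-2*p) ≤ 1 := by nlinarith
    have t2' : -1 ≤ p*(1-p)*(1-2*p) := by nlinarith
    have t3 : p*(1-p)^2 ≤ 1 := by nlinarith
    have t3' : 0 ≤ p*(1-p)^2 := by positivity
    have u2 := mul_le_mul_of_nonneg_left t2 hn0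
    have u2' := mul_le_mul_of_nonneg_left t2' hn0
    have u3 := mul_le_mul_of_nonneg_left t3 hn0
    have u3' := mul_nonneg hn0 t3'
    have hT : |n*p*(1-p)*(1-2*p) + 3 * n*p*(1-p)^2 + (1-p)^3| ≤ 60 * N := by
      rw [hN, abs_le]
      constructor <;> nlinarith
    have e : -(1-p)*p/(2*m) + (1-p)^2/(2*m) - (1-p)/(2*m) = -(p*(1-p)/m) := by
      field_simp; ring
    rw [e]
    refine (abs_sub _ _).trans (add_le_add ?_ ?_)
    · rw [abs_neg, abs_of_nonneg (by positivity)]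
      gcongr
      linarith
    · rw [abs_div, abs_of_pos (show 0 < 6*m^2 by positivity), div_le_div_iff₀ (by positivity) (by positivity)]
      have := mul_le_mul_of_nonneg_right hT (sq_nonneg m)
      linarith
  rw [← hm, ← hN]
  have hX : (1/(3*m^3)) * beE p n (fun k => ((k:ℝ)+1-m)^4) ≤ 20 / p^3 / N := by
    calc _ ≤ (1/(3*m^3)) * (20 * N^2) := mul_le_mul_of_nonneg_left h4 (by positivity)
      _ = (20/3) / p^3 / N := by rw [hmN]; field_simp
      _ ≤ _ := by gcongr; norm_num
  have hY : ((1-p)/2+1/2)/m ≤ 1 / p / N := by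
    calc _ ≤ 1 / m := by gcongr; linarith
      _ = _ := by rw [hmN]; field_simp
  have hZ : 2/m + 10*N/m^2 = (2/p + 10/p^2)/N := by rw [hmN]; field_simp
  have hW : (20/p^3 + 10/p^2 + 10/p)/N = 20 / p^3 / N + 1/p/N + (2/p + 10/p^2)/N + 7/p/N := by
    field_simp; ring
  have hV : 0 ≤ 7/p/N := by positivity
  have hV1 : 0 ≤ 20/p^3/N := by positivity
  have hV2 : 0 ≤ 1/p/N := by positivity
  rw [hZ] at hB
  have hB' := abs_le.1 hB
  rw [hW, abs_le]
  constructor <;> linarith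

/-- The binomial distribution `λ_k = C(n,k) p^k (1-p)^{n-k}` (the spectrum of
Alice's reduced state for `n` bunched photons through a beamsplitter with
transmission probability `p`) has Shannon entropy
`(1/2)·log₂(2πe·n·p·(1-p)) + O(1/n)`. -/
theorem binomial_entropy_asymptotics (p : ℝ) (hp0 : 0 < p) (hp1 : p < 1) :
    ∃ C : ℝ, ∀ n : ℕ, 1 ≤ n →
      |(-∑ k ∈ Finset.range (n + 1),
          ((n.choose k : ℝ) * p ^ k * (1 - p) ^ (n - k)) *
            Real.logb 2 ((n.choose k : ℝ) * p ^ k * (1 - p) ^ (n - k)))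
        - (1 / 2) * Real.logb 2 (2 * π * Real.exp 1 * n * p * (1 - p))|
        ≤ C / n := by
  have hq : 0 < 1 - p := by linarith
  obtain ⟨C1, hC1, h1⟩ := be_main p hp0 hp1
  obtain ⟨C2, hC2, h2⟩ := be_main (1-p) hq (by linarith)
  refine ⟨(C1 + C2 + 1) / log 2, fun n hn => ?_⟩
  have hn0 : (0:ℝ) < n := by exact_mod_cast hn
  have hlog2 : 0 < log 2 := log_pos (by norm_num)
  have hS : ∑ k ∈ Finset.range (n + 1),
          ((n.choose k : ℝ) * p ^ k * (1 - p) ^ (n - k)) *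
            Real.logb 2 ((n.choose k : ℝ) * p ^ k * (1 - p) ^ (n - k))
      = (log (n.factorial) - beE p n (fun k => log (k.factorial)) - beE (1-p) n (fun k => log (k.factorial))
          + n*p*log p + n*(1-p)*log (1-p)) / log 2 := by
    have hfun : ∀ k ∈ Finset.range (n+1), ((n.choose k : ℝ) * p ^ k * (1 - p) ^ (n - k)) *
            Real.logb 2 ((n.choose k : ℝ) * p ^ k * (1 - p) ^ (n - k)) =
        ((n.choose k : ℝ) * p ^ k * (1 - p) ^ (n - k)) * (log (n.factorial) - log (k.factorial) - log ((n-k).factorial) + k * log p + (n - k) * log (1-p)) / log 2 := by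
      intro k hk
      have hk : k ≤ n := by have := Finset.mem_range.1 hk; omega
      have hc : (n.choose k : ℝ) ≠ 0 := by exact_mod_cast (Nat.choose_pos hk).ne'
      have hf : (n.factorial : ℝ) = n.choose k * k.factorial * (n-k).factorial := by
        exact_mod_cast (Nat.choose_mul_factorial_mul_factorial hk).symm
      rw [logb, hf, log_mul (by positivity) (by positivity), log_mul (by positivity) (by positivity),
        log_mul (by positivity) (by positivity), log_mul (by positivity) (by positivity), log_pow, log_pow, Nat.cast_sub hk]
      ring
    rw [Finset.sum_congr rfl hfun, ← Finset.sum_div]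
    congr 1
    have e := beE_quartic p n (n*p*log p + n*(1-p)*log (1-p)) (log p - log (1-p)) 0 0 0
    have e' : (fun k : ℕ => (n*p*log p + n*(1-p)*log (1-p)) + (log p - log (1-p)) * ((k:ℝ) - n*p) + 0 * (k - n*p)^2 + 0 * (k-n*p)^3 + 0 * (k-n*p)^4) = fun k : ℕ => (k:ℝ) * log p + (n-k) * log (1-p) := by
      funext k; ring
    rw [e'] at e
    change beE p n (fun k => log (n.factorial) - log (k.factorial) - log ((n-k).factorial) + k * log p + (n - k) * log (1-p)) = _
    simp only [add_assoc]
    rw [beE_add, e, beE_sub, beE_sub, beE_const, beE_refl p n (fun k => log (k.factorial))]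
    ring
  have hR : logb 2 (2 * π * Real.exp 1 * n * p * (1 - p)) = (log (2*π) + 1 + log n + log p + log (1-p)) / log 2 := by
    rw [logb, log_mul (by positivity) (by positivity), log_mul (by positivity) (by positivity),
      log_mul (by positivity) (by positivity), log_mul (by positivity) (by positivity), log_exp]
  rw [hS, hR]
  have a1 := abs_le.1 (h1 n)
  have a2 := abs_le.1 (h2 n)
  obtain ⟨ε, b0, b1, b2⟩ := be_stirling n
  have hl1 : log n ≤ log ((n:ℝ)+1) := log_le_log hn0 (by linarith)
  have hl2 : log ((n:ℝ)+1) - log n ≤ 1/n := by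
    rw [← log_div (by positivity) (by positivity)]
    have := log_le_sub_one_of_pos (show 0 < ((n:ℝ)+1)/n by positivity)
    have e : ((n:ℝ)+1)/n - 1 = 1/n := by field_simp; ring
    linarith
  have c1 : C1/((n:ℝ)+1) ≤ C1/n := by gcongr; linarith
  have c2 : C2/((n:ℝ)+1) ≤ C2/n := by gcongr; linarith
  have c3 : 1/(2*((n:ℝ)+1)) ≤ 1/n := by gcongr; linarith
  have c4 : 0 ≤ 1/(n:ℝ) := by positivity
  have c3' : 1/(2*((n:ℝ)+1)) ≤ 1/n/2 := by
    rw [div_div]; gcongr 1 / ?_; linarith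
  rw [sub_sub_cancel, log_mul (x := (n:ℝ)+1) (by positivity) (by positivity)] at a2
  rw [log_mul (x := (n:ℝ)+1) (by positivity) (by positivity)] at a1
  have : ∀ A B : ℝ, -(A / log 2) - 1/2 * (B / log 2) = (-A - 1/2*B) / log 2 := by intro A B; ring
  rw [this, abs_div, abs_of_pos hlog2, div_div, mul_comm (log 2), ← div_div]
  gcongr
  rw [show (C1+C2+1)/(n:ℝ) = C1/n + C2/n + 1/n by ring, b2, abs_le]
  constructor <;> nlinarith
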